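/- arXiv:2005.05890 — 2 statements merged into one kernel-verified Lean document; each statement's English description precedes it below -/
import Mathlib

section
/- Let μ_N denote the standard Gaussian measure on ℝ^N, ν the standard normal distribution on ℝ, and define F(x) = ν { w ∈ ℝ : w² ≤ x } for x ≥ 0 (the cumulative distribution function of the chi-squared distribution with one degree of freedom). Let A ∈ ℝ^{N×N}, l ∈ ℕ, M ≥ 1, and γ > 0. Then under the M-fold product measure μ_N^{⊗M} on (ℝ^N)^M, the probability of the event { (z₁,…,z_M) : γ · max_{i=1,…,M} ‖A^l z_i‖₂² ≥ ‖A^l‖₂² } is at least 1 − F(1/γ)^M. -/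
open Matrix MeasureTheory ProbabilityTheory

/-- Squared-sum Euclidean 2-norm on `Fin N → ℝ`. -/
noncomputable def e2norm {N : ℕ} (v : Fin N → ℝ) : ℝ :=
  ‖(WithLp.equiv 2 (Fin N → ℝ)).symm v‖

/-- Operator 2-norm (largest singular value) of a square real matrix. -/
noncomputable def op2norm {N : ℕ} (A : Matrix (Fin N) (Fin N) ℝ) : ℝ :=
  ‖Matrix.toEuclideanCLM (𝕜 := ℝ) (n := Fin N) A‖

/-- In finite dimension the operator norm is dominated by the value at a point of the unit ball. -/
lemma ContinuousLinearMap.exists_norm_le_one_opNorm_le {E F : Type*} [NormedAddCommGroup E]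
    [NormedSpace ℝ E] [FiniteDimensional ℝ E] [NormedAddCommGroup F] [NormedSpace ℝ F]
    (T : E →L[ℝ] F) : ∃ u : E, ‖u‖ ≤ 1 ∧ ‖T‖ ≤ ‖T u‖ := by
  have := FiniteDimensional.proper ℝ E
  obtain ⟨u, hu, hmax⟩ := (isCompact_closedBall (0 : E) 1).exists_isMaxOn
    ⟨0, by simp⟩ (f := fun x => ‖T x‖) (by fun_prop)
  refine ⟨u, by simpa using hu, T.opNorm_le_of_unit_norm (norm_nonneg _) fun x hx => ?_⟩
  exact hmax (by simp [hx])

/-- A linear functional of norm one maps the standard Gaussian measure to `N(0, 1)`. -/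
lemma map_stdGaussian_of_norm_eq_one {E : Type*} [NormedAddCommGroup E] [InnerProductSpace ℝ E]
    [FiniteDimensional ℝ E] [MeasurableSpace E] [BorelSpace E] (L : StrongDual ℝ E)
    (hL : ‖L‖ = 1) : (stdGaussian E).map L = gaussianReal 0 1 := by
  rw [IsGaussian.map_eq_gaussianReal L, variance_dual_stdGaussian,
    integral_strongDual_stdGaussian, hL]
  simp

/-- For nonzero `T`, some functional of norm one satisfies `‖T‖ |L z| ≤ ‖T z‖` for all `z`. -/
lemma ContinuousLinearMap.exists_strongDual_norm_mul_le {E : Type*} [NormedAddCommGroup E]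
    [InnerProductSpace ℝ E] [FiniteDimensional ℝ E] (T : E →L[ℝ] E) (hT : 0 < ‖T‖) :
    ∃ L : StrongDual ℝ E, ‖L‖ = 1 ∧ ∀ z, ‖T‖ * |L z| ≤ ‖T z‖ := by
  have := FiniteDimensional.complete ℝ E
  obtain ⟨u, hu, hmax⟩ := (adjoint T).exists_norm_le_one_opNorm_le
  have hadj : ‖adjoint T‖ = ‖T‖ := LinearIsometryEquiv.norm_map _ _
  have hw : ‖adjoint T u‖ = ‖T‖ := by
    refine le_antisymm ?_ (hadj ▸ hmax)
    calc ‖adjoint T u‖ ≤ ‖adjoint T‖ * ‖u‖ := le_opNorm _ _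
      _ ≤ ‖T‖ := by rw [hadj]; exact mul_le_of_le_one_right hT.le hu
  refine ⟨‖T‖⁻¹ • innerSL ℝ (adjoint T u), ?_, fun z => ?_⟩
  · rw [norm_smul, innerSL_apply_norm, hw, norm_inv, norm_norm, inv_mul_cancel₀ hT.ne']
  · rw [_root_.smul_apply, innerSL_apply_apply, adjoint_inner_left, smul_eq_mul, abs_mul, abs_inv,
      abs_norm, mul_inv_cancel_left₀ hT.ne']
    calc |inner ℝ u (T z)| ≤ ‖u‖ * ‖T z‖ := abs_real_inner_le_norm _ _
      _ ≤ ‖T z‖ := mul_le_of_le_one_left (norm_nonneg _) hu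

/-- For `M` i.i.d. standard Gaussian vectors `z₁, …, z_M` on `ℝ^N`, the probability that
`γ · max_i ‖A^l z_i‖₂² ≥ ‖A^l‖₂²` is at least `1 − F(1/γ)^M`, where `F` is the CDF of the
chi-squared distribution with one degree of freedom. -/
theorem probabilistic_opnorm_bound
    (N : ℕ) (A : Matrix (Fin N) (Fin N) ℝ) (l M : ℕ) (hM : 1 ≤ M)
    (γ : ℝ) (hγ : 0 < γ) :
    1 - ((gaussianReal 0 1) {w : ℝ | w ^ 2 ≤ 1 / γ}) ^ M ≤
      (Measure.pi fun _ : Fin M => Measure.pi fun _ : Fin N => gaussianReal 0 1)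
        {z : Fin M → Fin N → ℝ |
          (op2norm (A ^ l)) ^ 2 ≤ γ * ⨆ i : Fin M, (e2norm ((A ^ l).mulVec (z i))) ^ 2} := by
  set B := A ^ l
  set T := Matrix.toEuclideanCLM (𝕜 := ℝ) (n := Fin N) B with hT
  have he (z : Fin N → ℝ) : e2norm (B.mulVec z) = ‖T (WithLp.toLp 2 z)‖ := by
    rw [hT, Matrix.toEuclideanCLM_toLp]; rfl
  have ho : op2norm B = ‖T‖ := rfl
  simp only [he, ho]
  set S := {z : Fin M → Fin N → ℝ |
    ‖T‖ ^ 2 ≤ γ * ⨆ i : Fin M, ‖T (WithLp.toLp 2 (z i))‖ ^ 2} with hS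
  rcases (norm_nonneg T).eq_or_lt with h0 | hpos
  · have : S = Set.univ := by
      refine Set.eq_univ_of_forall fun z => ?_
      rw [hS, Set.mem_ofPred_eq, ← h0, zero_pow two_ne_zero]
      exact mul_nonneg hγ.le (Real.iSup_nonneg fun i => sq_nonneg _)
    rw [this, measure_univ]
    exact tsub_le_self
  obtain ⟨L, hL, hLT⟩ := T.exists_strongDual_norm_mul_le hpos
  set K := {w : ℝ | w ^ 2 ≤ 1 / γ} with hK
  have hKm : MeasurableSet K := measurableSet_le (by fun_prop) (by fun_prop)
  have hlaw : (Measure.pi fun _ : Fin N => gaussianReal 0 1)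
      ((fun z => L (WithLp.toLp 2 z)) ⁻¹' K) = gaussianReal 0 1 K := by
    conv_rhs => rw [← map_stdGaussian_of_norm_eq_one L hL, ← map_pi_eq_stdGaussian,
      Measure.map_map (by fun_prop) (by fun_prop), Measure.map_apply (by fun_prop) hKm]
    rfl
  have hsub : Sᶜ ⊆ Set.univ.pi fun _ : Fin M => (fun z => L (WithLp.toLp 2 z)) ⁻¹' K := by
    intro z hz i _
    rw [hS, Set.mem_compl_iff, Set.mem_ofPred_eq, not_le] at hz
    rw [Set.mem_preimage, hK, Set.mem_ofPred_eq, le_div_iff₀ hγ]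
    have hi : ‖T (WithLp.toLp 2 (z i))‖ ^ 2 ≤ ⨆ i : Fin M, ‖T (WithLp.toLp 2 (z i))‖ ^ 2 :=
      le_ciSup (f := fun i => ‖T (WithLp.toLp 2 (z i))‖ ^ 2) (Set.finite_range _).bddAbove i
    have hsq := pow_le_pow_left₀ (by positivity) (hLT (WithLp.toLp 2 (z i))) 2
    rw [mul_pow, sq_abs] at hsq
    have hlt : ‖T‖ ^ 2 * (L (WithLp.toLp 2 (z i)) ^ 2 * γ) ≤ ‖T‖ ^ 2 * 1 := by
      nlinarith [mul_le_mul_of_nonneg_left (hsq.trans hi) hγ.le]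
    exact le_of_mul_le_mul_left hlt (by positivity)
  rw [tsub_le_iff_right]
  calc (1 : ENNReal)
      = (Measure.pi fun _ : Fin M => Measure.pi fun _ : Fin N => gaussianReal 0 1) (S ∪ Sᶜ) := by
        rw [Set.union_compl_self, measure_univ]
    _ ≤ _ := measure_union_le _ _
    _ ≤ _ := by
        gcongr
        refine (measure_mono hsub).trans_eq ?_
        rw [Measure.pi_pi]
        simp [hlaw]
end

section
/- Let A ∈ ℝ^{N×N}, B ∈ ℝ^{N×p}, V ∈ ℝ^{N×n}, Ã = VᵀAV, B̃ = VᵀB. Fix J ≥ 1, inputs g₁,…,g_J ∈ ℝ^p, an initial condition w₀ ∈ ℝ^N and w̃₀ ∈ ℝ^n; let w_{k+1} = A w_k + B g_{k+1} and w̃_{k+1} = Ã w̃_k + B̃ g_{k+1}, and set r_{k+1} = A V w̃_k + B g_{k+1} − V w̃_{k+1}. Fix M ≥ 1 and γ₁,…,γ_J > 0, and let μ_N^{⊗M} be the M-fold product of the standard Gaussian measure on ℝ^N, modelling M i.i.d. standard Gaussian vectors Z₁,…,Z_M. Define the random variables Ξ₀ = 1 and, for l = 1,…,J, Ξ_l =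 √( γ_l · max_{i=1,…,M} ‖A^l Z_i‖₂² ). Then the probability, under μ_N^{⊗M}, of the event that for every k ∈ {1,…,J} the inequality ‖w_k − V w̃_k‖₂ ≤ Ξ_k ‖w₀ − V w̃₀‖₂ + Σ_{l=0}^{k−1} Ξ_{k−l−1} ‖r_{l+1}‖₂ holds, is at least max( 0, 1 − Σ_{l=1}^{J} F(1/γ_l)^M ), where F(x) = ν { w ∈ ℝ : w² ≤ x } and ν is the standard normal distribution on ℝ. -/
open Matrix MeasureTheory ProbabilityTheory

open scoped RealInnerProductSpace in
/-- A continuous linear map between finite-dimensional spaces dominates a functional of the same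
norm. -/
lemma exists_abs_inner_le_norm_apply {E F : Type*}
    [NormedAddCommGroup E] [InnerProductSpace ℝ E] [FiniteDimensional ℝ E]
    [NormedAddCommGroup F] [InnerProductSpace ℝ F] [FiniteDimensional ℝ F] (T : E →L[ℝ] F) :
    ∃ u : E, ‖T‖ ≤ ‖u‖ ∧ ∀ z, |⟪u, z⟫| ≤ ‖T z‖ := by
  have : CompleteSpace E := FiniteDimensional.complete ℝ E
  have : CompleteSpace F := FiniteDimensional.complete ℝ F
  have : ProperSpace F := FiniteDimensional.proper ℝ F
  obtain ⟨v, hv, hmax⟩ := (isCompact_closedBall (0 : F) 1).exists_isMaxOn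
    ⟨0, by simp⟩ (T.adjoint.continuous.norm.continuousOn)
  refine ⟨T.adjoint v, ?_, fun z => ?_⟩
  · rw [← ContinuousLinearMap.adjoint.norm_map T]
    refine ContinuousLinearMap.opNorm_le_of_unit_norm (norm_nonneg _) fun x hx => ?_
    exact hmax (by simp [hx])
  · rw [ContinuousLinearMap.adjoint_inner_left]
    have hv' : ‖v‖ ≤ 1 := by simpa using hv
    calc |⟪v, T z⟫| ≤ ‖v‖ * ‖T z‖ := abs_real_inner_le_norm _ _
      _ ≤ ‖T z‖ := mul_le_of_le_one_left (norm_nonneg _) hv'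

open scoped RealInnerProductSpace in
lemma stdGaussian_inner_sq_le {E : Type*} [NormedAddCommGroup E] [InnerProductSpace ℝ E]
    [FiniteDimensional ℝ E] [MeasurableSpace E] [BorelSpace E] {a : E} (ha : ‖a‖ = 1) (c : ℝ) :
    stdGaussian E {z | ⟪a, z⟫ ^ 2 ≤ c} = gaussianReal 0 1 {x : ℝ | x ^ 2 ≤ c} := by
  have h : (stdGaussian E).map (innerSL ℝ a) = gaussianReal 0 1 := by
    rw [IsGaussian.map_eq_gaussianReal, integral_strongDual_stdGaussian, variance_dual_stdGaussian,
      innerSL_apply_norm, ha]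
    simp
  rw [← h, Measure.map_apply (by fun_prop) (measurableSet_le (by fun_prop) (by fun_prop))]
  rfl

/-- Outside an exceptional set of small probability, the values of a linear map at independent
standard Gaussian vectors control its operator norm. -/
lemma exists_exceptional_set_norm_apply_le {N : ℕ} (M : ℕ)
    (T : EuclideanSpace ℝ (Fin N) →L[ℝ] EuclideanSpace ℝ (Fin N)) {γ : ℝ} (hγ : 0 < γ) :
    ∃ S : Set (Fin M → Fin N → ℝ),
      (Measure.pi fun _ : Fin M => Measure.pi fun _ : Fin N => gaussianReal 0 1) S ≤
        gaussianReal 0 1 {x : ℝ | x ^ 2 ≤ 1 / γ} ^ M ∧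
      ∀ z ∉ S, ∀ x,
        ‖T x‖ ≤ Real.sqrt (γ * ⨆ i : Fin M, ‖T (WithLp.toLp 2 (z i))‖ ^ 2) * ‖x‖ := by
  obtain ⟨u, hTu, hu⟩ := exists_abs_inner_le_norm_apply T
  rcases eq_or_ne u 0 with rfl | hu0
  · refine ⟨∅, by simp, fun z _ x => ?_⟩
    have hT : T = 0 := norm_le_zero_iff.1 (by simpa using hTu)
    simp [hT]
  have hupos : 0 < ‖u‖ := norm_pos_iff.2 hu0
  set a := ‖u‖⁻¹ • u with ha
  have ha1 : ‖a‖ = 1 := norm_smul_inv_norm hu0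
  refine ⟨Set.univ.pi fun _ => {z | inner ℝ a (WithLp.toLp 2 z) ^ 2 ≤ 1 / γ}, ?_,
    fun z hz x => ?_⟩
  · rw [Measure.pi_pi, Finset.prod_const, Finset.card_univ, Fintype.card_fin,
      ← stdGaussian_inner_sq_le ha1, ← map_pi_eq_stdGaussian,
      Measure.map_apply (by fun_prop) (measurableSet_le (by fun_prop) (by fun_prop))]
    rfl
  · obtain ⟨i, hi⟩ : ∃ i, 1 / γ < inner ℝ a (WithLp.toLp 2 (z i)) ^ 2 := by
      simpa [Set.mem_pi] using hz
    refine (T.le_opNorm x).trans (mul_le_mul_of_nonneg_right ?_ (norm_nonneg x))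
    refine Real.le_sqrt_of_sq_le ?_
    have hsup : ‖T (WithLp.toLp 2 (z i))‖ ^ 2 ≤ ⨆ i : Fin M, ‖T (WithLp.toLp 2 (z i))‖ ^ 2 :=
      le_ciSup (f := fun i => ‖T (WithLp.toLp 2 (z i))‖ ^ 2) (Set.finite_range _).bddAbove i
    have hinner : inner ℝ u (WithLp.toLp 2 (z i)) = ‖u‖ * inner ℝ a (WithLp.toLp 2 (z i)) := by
      rw [ha, real_inner_smul_left, mul_inv_cancel_left₀ hupos.ne']
    calc ‖T‖ ^ 2 ≤ ‖u‖ ^ 2 := by gcongr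
      _ = γ * (‖u‖ ^ 2 * (1 / γ)) := by field_simp
      _ ≤ γ * (‖u‖ ^ 2 * inner ℝ a (WithLp.toLp 2 (z i)) ^ 2) := by gcongr
      _ = γ * |inner ℝ u (WithLp.toLp 2 (z i))| ^ 2 := by rw [sq_abs, hinner, mul_pow]
      _ ≤ γ * ‖T (WithLp.toLp 2 (z i))‖ ^ 2 := by gcongr; exact hu _
      _ ≤ _ := by gcongr

lemma eq_pow_mulVec_add_sum {R ι : Type*} [CommRing R] [Fintype ι] [DecidableEq ι]
    (A : Matrix ι ι R) (e r : ℕ → ι → R) (h : ∀ k, e (k + 1) = A.mulVec (e k) + r (k + 1)) (k : ℕ) :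
    e k = (A ^ k).mulVec (e 0) + ∑ l ∈ Finset.range k, (A ^ (k - l - 1)).mulVec (r (l + 1)) := by
  induction k with
  | zero => simp
  | succ k ih =>
    have hsum : A.mulVec (∑ l ∈ Finset.range k, (A ^ (k - l - 1)).mulVec (r (l + 1))) =
        ∑ l ∈ Finset.range k, (A ^ (k + 1 - l - 1)).mulVec (r (l + 1)) := by
      rw [Matrix.mulVec_sum]
      refine Finset.sum_congr rfl fun l hl => ?_
      have hl' := Finset.mem_range.1 hl
      rw [Matrix.mulVec_mulVec, ← pow_succ', show k - l - 1 + 1 = k + 1 - l - 1 by omega]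
    rw [h, ih, Matrix.mulVec_add, Matrix.mulVec_mulVec, ← pow_succ', hsum, Finset.sum_range_succ]
    simp [add_assoc]

lemma e2norm_add_le {N : ℕ} (x y : Fin N → ℝ) : e2norm (x + y) ≤ e2norm x + e2norm y :=
  norm_add_le (WithLp.toLp 2 x) (WithLp.toLp 2 y)

lemma e2norm_sum_le {N : ℕ} {ι : Type*} (s : Finset ι) (f : ι → Fin N → ℝ) :
    e2norm (∑ i ∈ s, f i) ≤ ∑ i ∈ s, e2norm (f i) :=
  Finset.le_sum_of_subadditive e2norm (by simp [e2norm]) e2norm_add_le s f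

/-- Probabilistic a posteriori error estimator: with probability at least
`max(0, 1 − Σ_{l=1}^J F(1/γ_l)^M)` over `M` i.i.d. standard Gaussian vectors, the
state errors at all steps `k = 1, …, J` are bounded by
`Ξ_k ‖w₀ − V w̃₀‖₂ + Σ_{l=0}^{k−1} Ξ_{k−l−1} ‖r_{l+1}‖₂`. -/
theorem probabilistic_a_posteriori_state_error_bound
    (N n p J M : ℕ) (hJ : 1 ≤ J) (hM : 1 ≤ M)
    (A : Matrix (Fin N) (Fin N) ℝ) (B : Matrix (Fin N) (Fin p) ℝ)
    (V : Matrix (Fin N) (Fin n) ℝ)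
    (g : ℕ → Fin p → ℝ) (w : ℕ → Fin N → ℝ) (wt : ℕ → Fin n → ℝ) (r : ℕ → Fin N → ℝ)
    (hw : ∀ k, w (k + 1) = A.mulVec (w k) + B.mulVec (g (k + 1)))
    (hwt : ∀ k, wt (k + 1) =
      (Vᵀ * A * V).mulVec (wt k) + (Vᵀ * B).mulVec (g (k + 1)))
    (hr : ∀ k, r (k + 1) =
      A.mulVec (V.mulVec (wt k)) + B.mulVec (g (k + 1)) - V.mulVec (wt (k + 1)))
    (γ : ℕ → ℝ) (hγ : ∀ l, 1 ≤ l → l ≤ J → 0 < γ l)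
    (Xi : (Fin M → Fin N → ℝ) → ℕ → ℝ)
    (hXi0 : ∀ z, Xi z 0 = 1)
    (hXi : ∀ z l, 1 ≤ l →
      Xi z l = Real.sqrt (γ l * ⨆ i : Fin M, (e2norm ((A ^ l).mulVec (z i))) ^ 2)) :
    1 - ∑ l ∈ Finset.Icc 1 J, ((gaussianReal 0 1) {x : ℝ | x ^ 2 ≤ 1 / γ l}) ^ M ≤
      (Measure.pi fun _ : Fin M => Measure.pi fun _ : Fin N => gaussianReal 0 1)
        {z : Fin M → Fin N → ℝ | ∀ k, 1 ≤ k → k ≤ J →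
          e2norm (w k - V.mulVec (wt k)) ≤
            Xi z k * e2norm (w 0 - V.mulVec (wt 0))
            + ∑ l ∈ Finset.range k, Xi z (k - l - 1) * e2norm (r (l + 1))} := by
  let μ : Measure (Fin M → Fin N → ℝ) :=
    Measure.pi fun _ : Fin M => Measure.pi fun _ : Fin N => gaussianReal 0 1
  have hex : ∀ l, ∃ S : Set (Fin M → Fin N → ℝ), l ∈ Finset.Icc 1 J →
      μ S ≤ gaussianReal 0 1 {x : ℝ | x ^ 2 ≤ 1 / γ l} ^ M ∧
      ∀ z ∉ S, ∀ x, e2norm ((A ^ l).mulVec x) ≤ Xi z l * e2norm x := by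
    intro l
    by_cases hl : l ∈ Finset.Icc 1 J
    · obtain ⟨h1, hlJ⟩ := Finset.mem_Icc.1 hl
      obtain ⟨S, hS, hbound⟩ := exists_exceptional_set_norm_apply_le M
        (Matrix.toEuclideanCLM (𝕜 := ℝ) (A ^ l)) (hγ l h1 hlJ)
      refine ⟨S, fun _ => ⟨hS, fun z hz x => ?_⟩⟩
      rw [hXi z l h1]
      exact hbound z hz (WithLp.toLp 2 x)
    · exact ⟨∅, fun h => absurd h hl⟩
  choose S hS using hex
  have herr := eq_pow_mulVec_add_sum A (fun k => w k - V.mulVec (wt k)) r fun k => by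
    simp only [hr, hw k, Matrix.mulVec_sub]
    abel
  have hunion : μ (⋃ l ∈ Finset.Icc 1 J, S l) ≤
      ∑ l ∈ Finset.Icc 1 J, gaussianReal 0 1 {x : ℝ | x ^ 2 ≤ 1 / γ l} ^ M :=
    (measure_biUnion_finset_le _ _).trans (Finset.sum_le_sum fun l hl => (hS l hl).1)
  rw [tsub_le_iff_right]
  calc (1 : ENNReal) = μ Set.univ := measure_univ.symm
    _ ≤ μ ((⋃ l ∈ Finset.Icc 1 J, S l)ᶜ ∪ ⋃ l ∈ Finset.Icc 1 J, S l) := by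
      rw [Set.compl_union_self]
    _ ≤ μ (⋃ l ∈ Finset.Icc 1 J, S l)ᶜ + μ (⋃ l ∈ Finset.Icc 1 J, S l) := measure_union_le _ _
    _ ≤ _ := add_le_add (measure_mono ?_) hunion
  intro z hz k hk1 hkJ
  have hpow : ∀ l ≤ J, ∀ x, e2norm ((A ^ l).mulVec x) ≤ Xi z l * e2norm x := by
    intro l hl x
    rcases Nat.eq_zero_or_pos l with rfl | hpos
    · simp [hXi0]
    · have hmem : l ∈ Finset.Icc 1 J := Finset.mem_Icc.2 ⟨hpos, hl⟩
      exact (hS l hmem).2 z (fun h => hz (Set.mem_biUnion hmem h)) x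
  rw [herr k]
  refine (e2norm_add_le _ _).trans (add_le_add (hpow k hkJ _) ?_)
  exact (e2norm_sum_le _ _).trans (Finset.sum_le_sum fun l _ => hpow _ (by omega) _)
end
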